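/- Let (X_0,Y_0), (X_1,Y_1), ..., (X_n,Y_n) be exchangeable random pairs with X_i valued in ℝ^l and Y_i valued in ℝ^p, let h : ℝ^l → ℝ^p be a measurable predictor, let f_1, ..., f_K : ℝ^p → ℝ be measurable shape template functions with positive normalization constants α_1, ..., α_K > 0, and define the joint score R_{S_c}(z) := min_{k} α_k f_k(z) and R_i := R_{S_c}(Y_i − h(X_i)). Let δ ∈ (0,1), set q = ⌈(n+1)(1−δ)⌉, assume q ≤ n, and let C be the q-th smallest value among R_1, ..., R_n. Then Prob(Y_0 ∈ ⋃_{k=1}^{K} {y ∈ ℝ^p : f_k(y − h(X_0)) ≤ C/α_k}) ≥ 1 − δ. -/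

import Mathlib

open MeasureTheory

lemma aux_count {m : ℕ} (r : Fin m → ℝ) (q : ℕ) (hq : q ≤ m) :
    q ≤ (Finset.univ.filter fun j => (Finset.univ.filter fun i => r i < r j).card < q).card := by
  have hm := Tuple.monotone_sort r
  set σ := Tuple.sort r
  have h1 : ((Finset.univ : Finset (Fin q)).image fun k => σ (Fin.castLE hq k)) ⊆
      (Finset.univ.filter fun j => (Finset.univ.filter fun i => r i < r j).card < q) := by
    intro j hj
    simp only [Finset.mem_image, Finset.mem_univ, true_and] at hj
    obtain ⟨k, rfl⟩ := hj
    simp only [Finset.mem_filter, Finset.mem_univ, true_and]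
    have h2 : (Finset.univ.filter fun i => r i < r (σ (Fin.castLE hq k))) ⊆
        (Finset.Iio (Fin.castLE hq k)).image σ := by
      intro i hi
      simp only [Finset.mem_filter, Finset.mem_univ, true_and] at hi
      simp only [Finset.mem_image, Finset.mem_Iio]
      refine ⟨σ.symm i, ?_, by simp⟩
      by_contra hc
      have := hm (not_lt.mp hc)
      simp at this
      linarith
    calc _ ≤ _ := Finset.card_le_card h2
      _ ≤ _ := Finset.card_image_le
      _ = k := by simp
      _ < q := k.2
  have h3 := Finset.card_le_card h1
  rw [Finset.card_image_of_injective] at h3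
  · simpa using h3
  · intro a b hab
    simpa using hab

lemma aux_sorted (L : List ℝ) (hL : L.Pairwise (· ≤ ·)) (q : ℕ) (hq0 : 0 < q)
    (hq : q ≤ L.length) (x : ℝ) (hx : L.getD (q - 1) 0 < x) :
    q ≤ L.countP (fun y => decide (y < x)) := by
  have h1 : (L.take q).countP (fun y => decide (y < x)) = (L.take q).length := by
    rw [List.countP_eq_length]
    intro a ha
    obtain ⟨i, hi, rfl⟩ := List.mem_iff_getElem.mp ha
    simp only [List.length_take, lt_inf_iff] at hi
    rw [List.getD_eq_getElem _ _ (by omega)] at hx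
    simp only [List.getElem_take, decide_eq_true_eq]
    refine lt_of_le_of_lt ?_ hx
    rcases Nat.lt_or_ge i (q-1) with h | h
    · exact List.pairwise_iff_getElem.mp hL i (q-1) _ _ h
    · have : i = q - 1 := by omega
      subst this; exact le_rfl
  have h2 := (List.take_sublist q L).countP_le (p := fun y => decide (y < x))
  rw [h1] at h2
  simpa [hq] using h2

lemma aux_quant {n : ℕ} (r : Fin (n+1) → ℝ) (q : ℕ) (hq0 : 0 < q) (hq : q ≤ n)
    (hx : (Finset.univ.filter fun i => r i < r 0).card < q) :
    r 0 ≤ ((List.ofFn fun i : Fin n => r i.succ).mergeSort (· ≤ ·)).getD (q - 1) 0 := by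
  by_contra hc
  have h1 := aux_sorted _ (List.pairwise_mergeSort' (· ≤ ·) _) q hq0 (by simpa using hq) _
    (not_le.mp hc)
  rw [(List.mergeSort_perm _ _).countP_eq] at h1
  have h2 : (List.ofFn fun i : Fin n => r i.succ).countP (fun y => decide (y < r 0))
      = (Finset.univ.filter fun i : Fin n => r i.succ < r 0).card := by
    rw [List.ofFn_eq_map, List.countP_map, List.countP_eq_length_filter]
    rfl
  rw [h2] at h1
  have h3 : (Finset.univ.filter fun i : Fin n => r i.succ < r 0).card ≤
      (Finset.univ.filter fun i => r i < r 0).card := by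
    refine Finset.card_le_card_of_injOn Fin.succ ?_ (Fin.succ_injective n).injOn
    intro i hi
    simpa using hi
  omega

lemma aux_prob {Ω E : Type*} [MeasurableSpace Ω] [MeasurableSpace E] (μ : Measure Ω)
    [IsProbabilityMeasure μ] (n : ℕ) (Z : Fin (n+1) → Ω → E) (hZ : ∀ i, Measurable (Z i))
    (hexch : ∀ σ : Equiv.Perm (Fin (n + 1)),
      Measure.map (fun ω => fun i => Z (σ i) ω) μ = Measure.map (fun ω => fun i => Z i ω) μ)
    (s : E → ℝ) (hs : Measurable s) (q : ℕ) (hq : q ≤ n + 1) :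
    (q : ENNReal) ≤ (n + 1 : ℕ) *
      μ {ω | (Finset.univ.filter fun i => s (Z i ω) < s (Z 0 ω)).card < q} := by
  have hmeasS : ∀ j, MeasurableSet {z : Fin (n+1) → E |
      (Finset.univ.filter fun i => s (z i) < s (z j)).card < q} := by
    intro j
    simp only [Finset.card_filter]
    refine measurableSet_lt (Finset.measurable_sum _ fun i _ => ?_) measurable_const
    refine Measurable.ite (measurableSet_lt ?_ ?_) measurable_const measurable_const <;> fun_prop
  let A : Fin (n+1) → Set Ω := fun j =>
    {ω | (Finset.univ.filter fun i => s (Z i ω) < s (Z j ω)).card < q}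
  have hA : ∀ j, MeasurableSet (A j) := fun j =>
    (measurable_pi_lambda (fun ω i => Z i ω) hZ) (hmeasS j)
  have hAeq : ∀ j, μ (A j) = μ (A 0) := by
    intro j
    have h := congrArg (fun ν => ν {z : Fin (n+1) → E |
      (Finset.univ.filter fun i => s (z i) < s (z 0)).card < q}) (hexch (Equiv.swap 0 j))
    rw [Measure.map_apply (measurable_pi_lambda _ fun i => hZ _) (hmeasS 0),
      Measure.map_apply (measurable_pi_lambda _ fun i => hZ _) (hmeasS 0)] at h
    refine Eq.trans ?_ h
    congr 1
    ext ω
    simp only [A, Set.mem_preimage, Set.mem_ofPred_eq, Equiv.swap_apply_left]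
    have : (Finset.univ.filter fun i => s (Z i ω) < s (Z j ω)).card =
        (Finset.univ.filter fun i => s (Z (Equiv.swap 0 j i) ω) < s (Z j ω)).card := by
      simp only [Finset.card_filter]
      exact (Equiv.sum_comp (Equiv.swap 0 j)
        (fun i => if s (Z i ω) < s (Z j ω) then 1 else 0)).symm
    rw [this]
  have hsum : ∑ j, μ (A j) = (n + 1 : ℕ) * μ (A 0) := by
    simp [hAeq]
  change _ ≤ _ * μ (A 0)
  rw [← hsum]
  calc (q : ENNReal) = ∫⁻ _, (q : ENNReal) ∂μ := by simp
    _ ≤ ∫⁻ ω, ∑ j, (A j).indicator 1 ω ∂μ := by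
        refine lintegral_mono fun ω => ?_
        have h := aux_count (fun i => s (Z i ω)) q hq
        rw [Finset.card_filter] at h
        have h' : (q : ENNReal) ≤ ((∑ j, if (Finset.univ.filter fun i => s (Z i ω) < s (Z j ω)).card < q then 1 else 0 : ℕ) : ENNReal) := by
          exact_mod_cast h
        refine h'.trans (le_of_eq ?_)
        push_cast
        refine Finset.sum_congr rfl fun j _ => ?_
        simp [A, Set.indicator_apply]
    _ = ∑ j, μ (A j) := by
        rw [lintegral_finsetSum _ (fun j _ => measurable_one.indicator (hA j))]
        refine Finset.sum_congr rfl fun j _ => ?_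
        exact lintegral_indicator_one (hA j)

/-- Validity of multi-modal conformal prediction regions: with exchangeable pairs
`(X i, Y i)`, a measurable predictor `h`, shape template functions `f k` with
positive normalization constants `α k`, joint score `R i ω = min_k α k * f k (Y i ω - h (X i ω))`,
`δ ∈ (0,1)`, `q = ⌈(n+1)(1-δ)⌉ ≤ n`, and `C` the `q`-th smallest of `R 1, ..., R n`,
the union region `⋃ k {y | f k (y - h (X 0)) ≤ C / α k}` contains `Y 0` with
probability at least `1 - δ`. -/
theorem multimodal_conformal_region_coverage
    {Ω : Type*} [MeasurableSpace Ω] (μ : Measure Ω) [IsProbabilityMeasure μ]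
    (n l p K : ℕ) (hK : 1 ≤ K)
    (X : Fin (n + 1) → Ω → (Fin l → ℝ)) (Y : Fin (n + 1) → Ω → (Fin p → ℝ))
    (hXmeas : ∀ i, Measurable (X i)) (hYmeas : ∀ i, Measurable (Y i))
    (hexch : ∀ σ : Equiv.Perm (Fin (n + 1)),
      Measure.map (fun ω => fun i => (X (σ i) ω, Y (σ i) ω)) μ
        = Measure.map (fun ω => fun i => (X i ω, Y i ω)) μ)
    (h : (Fin l → ℝ) → (Fin p → ℝ)) (hh : Measurable h)
    (f : Fin K → (Fin p → ℝ) → ℝ) (hf : ∀ k, Measurable (f k))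
    (α : Fin K → ℝ) (hα : ∀ k, 0 < α k)
    (R : Fin (n + 1) → Ω → ℝ)
    (hR : ∀ i ω, R i ω =
      Finset.univ.inf' ⟨⟨0, hK⟩, Finset.mem_univ _⟩ fun k => α k * f k (Y i ω - h (X i ω)))
    (δ : ℝ) (hδ0 : 0 < δ) (hδ1 : δ < 1)
    (q : ℕ) (hq : q = ⌈((n : ℝ) + 1) * (1 - δ)⌉₊) (hqn : q ≤ n)
    (C : Ω → ℝ)
    (hC : ∀ ω, C ω =
      ((List.ofFn fun i : Fin n => R i.succ ω).mergeSort (· ≤ ·)).getD (q - 1) 0) :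
    ENNReal.ofReal (1 - δ)
      ≤ μ {ω | Y 0 ω ∈ ⋃ k : Fin K,
            {y : Fin p → ℝ | f k (y - h (X 0 ω)) ≤ C ω / α k}} := by
  have hq0 : 0 < q := by
    rw [hq]; apply Nat.ceil_pos.mpr
    have : 0 < 1 - δ := by linarith
    positivity
  let s : (Fin l → ℝ) × (Fin p → ℝ) → ℝ := fun z =>
    Finset.univ.inf' ⟨⟨0, hK⟩, Finset.mem_univ _⟩ fun k => α k * f k (z.2 - h z.1)
  have hs : Measurable s := by
    refine measurable_of_Iio fun a => ?_
    have : s ⁻¹' Set.Iio a = ⋃ k : Fin K,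
        {z : (Fin l → ℝ) × (Fin p → ℝ) | α k * f k (z.2 - h z.1) < a} := by
      ext z
      simp only [Set.mem_preimage, Set.mem_Iio, Set.mem_iUnion, Set.mem_ofPred_eq]
      refine (Finset.inf'_lt_iff _).trans ?_
      simp
    rw [this]
    refine MeasurableSet.iUnion fun k => measurableSet_lt ?_ measurable_const
    exact ((hf k).comp (measurable_snd.sub (hh.comp measurable_fst))).const_mul _
  have key := aux_prob μ n (fun i ω => (X i ω, Y i ω))
    (fun i => (hXmeas i).prodMk (hYmeas i)) hexch s hs q (by omega)
  have hsR : ∀ i ω, s (X i ω, Y i ω) = R i ω := fun i ω => (hR i ω).symm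
  simp only [hsR] at key
  have hsub : {ω | (Finset.univ.filter fun i => R i ω < R 0 ω).card < q} ⊆
      {ω | Y 0 ω ∈ ⋃ k : Fin K, {y : Fin p → ℝ | f k (y - h (X 0 ω)) ≤ C ω / α k}} := by
    intro ω hω
    have h1 := aux_quant (fun i => R i ω) q hq0 hqn hω
    rw [← hC ω, hR 0 ω] at h1
    obtain ⟨k, -, hk⟩ := (Finset.inf'_le_iff _).mp h1
    simp only [Set.mem_ofPred_eq, Set.mem_iUnion]
    refine ⟨k, ?_⟩
    rw [le_div_iff₀ (hα k), mul_comm]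
    exact hk
  refine le_trans ?_ (measure_mono hsub)
  have hle : ((n + 1 : ℕ) : ENNReal) * ENNReal.ofReal (1 - δ) ≤ q := by
    rw [← ENNReal.ofReal_natCast, ← ENNReal.ofReal_natCast q,
      ← ENNReal.ofReal_mul (by positivity)]
    apply ENNReal.ofReal_le_ofReal
    rw [hq]; push_cast
    exact Nat.le_ceil _
  have := hle.trans key
  exact (ENNReal.mul_le_mul_iff_right (by simp) (ENNReal.natCast_ne_top _)).mp this
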